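/- Let (c_k)_{k≥0} be a sequence of positive integers and let T be the spherically symmetric rooted tree in which every vertex at level k has exactly c_k children. For each n, let E_n denote the (finite) set of edges of T between levels 0 and n, and let f_n : {0,1}^{E_n} → {0,1} be the indicator that there is a path from the root to some vertex at level n all of whose edges are in state 1. Then the sequence {f_n} is noise stable with respect to p_n ≡ 1/2. -/

import Mathlib

open MeasureTheory

/-- Number of vertices at level `k` of the spherically symmetric tree in which every
vertex at level `j` has exactly `c j` children. -/
def numV (c : ℕ → ℕ) : ℕ → ℕ
  | 0 => 1
  | k+1 => numV c k * c k

/-- The set of edges of the tree between levels 0 and n: an edge is identified with its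
lower endpoint, a vertex at some level k+1 with k < n. -/
abbrev TEdge (c : ℕ → ℕ) (n : ℕ) : Type := (k : Fin n) × Fin (numV c (k.1 + 1))

/-- Whether the vertex `v` at level `n` is connected to the root by edges in state 1. -/
def connToRoot (c : ℕ → ℕ) (hc : ∀ k, 0 < c k) :
    (n : ℕ) → (TEdge c n → Bool) → Fin (numV c n) → Bool
  | 0, _, _ => true
  | n+1, ω, v =>
    ω ⟨⟨n, Nat.lt_succ_self n⟩, v⟩ &&
    connToRoot c hc n (fun e => ω ⟨⟨e.1.1, Nat.lt_succ_of_lt e.1.2⟩, e.2⟩)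
      ⟨v.1 / c n, by
        have hv := v.isLt
        have h : numV c (n+1) = numV c n * c n := rfl
        exact (Nat.div_lt_iff_lt_mul (hc n)).mpr (by omega)⟩

/-- The percolation crossing function: 1 iff some vertex at level `n` is connected to
the root using only edges in state 1. -/
def crossing (c : ℕ → ℕ) (hc : ∀ k, 0 < c k) (n : ℕ) (ω : TEdge c n → Bool) : Bool :=
  decide (∃ v : Fin (numV c n), connToRoot c hc n ω v = true)

/-- The Bernoulli(p) measure on `Bool` (probability `p` of `true`). -/
noncomputable def bern (p : ℝ) : Measure Bool :=
  ENNReal.ofReal p • Measure.dirac true + ENNReal.ofReal (1 - p) • Measure.dirac false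

/-- Joint law of (ω_e, fresh bit, resample indicator), per edge. -/
noncomputable def noiseμ (ι : Type) [Fintype ι] (p ε : ℝ) :
    Measure (ι → Bool × Bool × Bool) :=
  Measure.pi fun _ => (bern p).prod ((bern p).prod (bern ε))

/-- The original configuration ω. -/
def obs {ι : Type} (σ : ι → Bool × Bool × Bool) : ι → Bool := fun i => (σ i).1

/-- The noised configuration ω^ε. -/
def pert {ι : Type} (σ : ι → Bool × Bool × Bool) : ι → Bool :=
  fun i => if (σ i).2.2 then (σ i).2.1 else (σ i).1

open ProbabilityTheory in
/-- Precomposition with an injection maps a product of copies of `μ` to a product of copies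
of `μ`. -/
lemma measurePreserving_pi_comp_injective {ι κ α : Type} [Fintype ι] [Fintype κ]
    [MeasurableSpace α] (μ : Measure α) [IsProbabilityMeasure μ] (g : κ → ι)
    (hg : Function.Injective g) :
    MeasurePreserving (fun (x : ι → α) => x ∘ g)
      (Measure.pi fun _ => μ) (Measure.pi fun _ => μ) := by
  refine ⟨by fun_prop, ?_⟩
  have h : iIndepFun (fun (i : ι) (x : ι → α) => x i) (Measure.pi fun _ => μ) :=
    iIndepFun_pi (μ := fun _ : ι => μ) (X := fun _ a => a) (fun _ => aemeasurable_id)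
  have h' := h.precomp hg
  rw [iIndepFun_iff_map_fun_eq_pi_map (fun i => (measurable_pi_apply (g i)).aemeasurable)] at h'
  have hmap : ∀ i, (Measure.pi fun _ : ι => μ).map (fun x => x (g i)) = μ :=
    fun i => (measurePreserving_eval (fun _ : ι => μ) (g i)).map_eq
  simp only [hmap] at h'
  exact h'

lemma isProbabilityMeasure_bern {p : ℝ} (h0 : 0 ≤ p) (h1 : p ≤ 1) :
    IsProbabilityMeasure (bern p) := by
  refine ⟨?_⟩
  simp [bern, ← ENNReal.ofReal_add h0 (sub_nonneg.2 h1)]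

lemma bern_singleton_true (p : ℝ) : bern p {true} = ENNReal.ofReal p := by
  simp [bern]

/-- Resampling a Bernoulli bit does not change its law. -/
lemma measurePreserving_resample (μ ν : Measure Bool) [IsProbabilityMeasure μ]
    [IsProbabilityMeasure ν] :
    MeasurePreserving (fun x : Bool × Bool × Bool => if x.2.2 then x.2.1 else x.1)
      (μ.prod (μ.prod ν)) μ := by
  refine ⟨measurable_of_finite _, Measure.ext_of_singleton fun b => ?_⟩
  rw [Measure.map_apply (measurable_of_finite _) (measurableSet_singleton b)]
  have hset : (fun x : Bool × Bool × Bool => if x.2.2 then x.2.1 else x.1) ⁻¹' {b}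
      = (Set.univ ×ˢ ({b} ×ˢ {true})) ∪ ({b} ×ˢ (Set.univ ×ˢ {false})) := by
    ext ⟨x, y, z⟩
    cases z <;> simp
  have hdisj : Disjoint ((Set.univ : Set Bool) ×ˢ (({b} : Set Bool) ×ˢ ({true} : Set Bool)))
      (({b} : Set Bool) ×ˢ ((Set.univ : Set Bool) ×ˢ ({false} : Set Bool))) := by
    rw [Set.disjoint_left]
    rintro ⟨x, y, z⟩
    cases z <;> simp
  have hν : ν {true} + ν {false} = 1 := by
    rw [← measure_union (by simp) (measurableSet_singleton _), ← measure_univ (μ := ν)]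
    congr 1
    ext z
    cases z <;> simp
  rw [hset, measure_union hdisj (Set.toFinite _).measurableSet]
  simp only [Measure.prod_prod, measure_univ, one_mul]
  rw [← mul_add, hν, mul_one]

section Marginals

variable {ι : Type} [Fintype ι] {p ε : ℝ}

lemma measurePreserving_obs (hp0 : 0 ≤ p) (hp1 : p ≤ 1) (hε0 : 0 ≤ ε) (hε1 : ε ≤ 1) :
    MeasurePreserving (obs (ι := ι)) (noiseμ ι p ε) (Measure.pi fun _ => bern p) := by
  have := isProbabilityMeasure_bern hp0 hp1
  have := isProbabilityMeasure_bern hε0 hε1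
  exact measurePreserving_pi _ _ fun _ => measurePreserving_fst

lemma measurePreserving_pert (hp0 : 0 ≤ p) (hp1 : p ≤ 1) (hε0 : 0 ≤ ε) (hε1 : ε ≤ 1) :
    MeasurePreserving (pert (ι := ι)) (noiseμ ι p ε) (Measure.pi fun _ => bern p) := by
  have := isProbabilityMeasure_bern hp0 hp1
  have := isProbabilityMeasure_bern hε0 hε1
  exact measurePreserving_pi _ _ fun _ => measurePreserving_resample _ _

/-- The configuration changes under noise with probability at most `ε` times the number of
coordinates. -/
lemma noiseμ_obs_ne_pert_le (hp0 : 0 ≤ p) (hp1 : p ≤ 1) (hε0 : 0 ≤ ε) (hε1 : ε ≤ 1) :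
    (noiseμ ι p ε) {σ | obs σ ≠ pert σ} ≤ Fintype.card ι * ENNReal.ofReal ε := by
  have := isProbabilityMeasure_bern hp0 hp1
  have := isProbabilityMeasure_bern hε0 hε1
  have hsub : {σ : ι → Bool × Bool × Bool | obs σ ≠ pert σ}
      ⊆ ⋃ i ∈ (Finset.univ : Finset ι), {σ | (σ i).2.2 = true} := by
    intro σ hσ
    obtain ⟨i, hi⟩ := Function.ne_iff.1 hσ
    simp only [Finset.mem_univ, Set.iUnion_true, Set.mem_iUnion, Set.mem_ofPred_eq]
    refine ⟨i, ?_⟩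
    by_contra h
    exact hi (by simp [obs, pert, h])
  have hone : ∀ i : ι, (noiseμ ι p ε) {σ | (σ i).2.2 = true} = ENNReal.ofReal ε := by
    intro i
    have h := (measurePreserving_eval
      (fun _ : ι => (bern p).prod ((bern p).prod (bern ε))) i)
    have h2 := (measurePreserving_snd.comp measurePreserving_snd).comp h
    rw [← bern_singleton_true ε,
      ← h2.measure_preimage (measurableSet_singleton true).nullMeasurableSet]
    rfl
  calc _ ≤ _ := measure_mono hsub
    _ ≤ ∑ i : ι, (noiseμ ι p ε) {σ | (σ i).2.2 = true} := measure_biUnion_finset_le _ _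
    _ = _ := by simp [hone]

end Marginals

/-- The inclusion of the edges above level `m` into the edges above level `n`. -/
def liftEdge (c : ℕ → ℕ) {m n : ℕ} (h : m ≤ n) (e : TEdge c m) : TEdge c n :=
  ⟨⟨e.1.1, e.1.2.trans_le h⟩, e.2⟩

lemma liftEdge_injective (c : ℕ → ℕ) {m n : ℕ} (h : m ≤ n) :
    Function.Injective (liftEdge c h) := by
  rintro ⟨⟨i, hi⟩, x⟩ ⟨⟨j, hj⟩, y⟩ hxy
  simp only [liftEdge, Sigma.mk.injEq, Fin.mk.injEq] at hxy
  obtain ⟨rfl, hxy⟩ := hxy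
  rw [eq_of_heq hxy]

lemma crossing_of_le (c : ℕ → ℕ) (hc : ∀ k, 0 < c k) {m n : ℕ} (h : m ≤ n)
    (ω : TEdge c n → Bool) (hω : crossing c hc n ω = true) :
    crossing c hc m (ω ∘ liftEdge c h) = true := by
  induction n, h using Nat.le_induction with
  | base => exact hω
  | succ n h ih =>
    refine ih (ω ∘ liftEdge c (Nat.le_succ n)) ?_
    obtain ⟨v, hv⟩ := of_decide_eq_true hω
    rw [connToRoot, Bool.and_eq_true] at hv
    exact decide_eq_true ⟨_, hv.2⟩

/-- The critical probability that level `n` is reached from the root. -/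
noncomputable def crossingProb (c : ℕ → ℕ) (hc : ∀ k, 0 < c k) (n : ℕ) : ℝ :=
  (Measure.pi fun _ : TEdge c n => bern (1/2)).real {ω | crossing c hc n ω = true}

/-- Level `m` but not level `n ≥ m` is reached with probability the difference of the
crossing probabilities. -/
lemma measureReal_crossing_diff (c : ℕ → ℕ) (hc : ∀ k, 0 < c k) {m n : ℕ} (h : m ≤ n) :
    (Measure.pi fun _ : TEdge c n => bern (1/2)).real
      ({ω | crossing c hc m (ω ∘ liftEdge c h) = true} \ {ω | crossing c hc n ω = true})
      = crossingProb c hc m - crossingProb c hc n := by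
  have := isProbabilityMeasure_bern (p := 1/2) (by norm_num) (by norm_num)
  have hsub : {ω | crossing c hc n ω = true}
      ⊆ {ω | crossing c hc m (ω ∘ liftEdge c h) = true} :=
    fun ω hω => crossing_of_le c hc h ω hω
  rw [measureReal_sdiff hsub (Set.toFinite _).measurableSet]
  congr 1
  exact (measurePreserving_pi_comp_injective (bern (1/2)) _
    (liftEdge_injective c h)).measureReal_preimage
      (Set.toFinite {ω | crossing c hc m ω = true}).measurableSet.nullMeasurableSet

/-- The crossing probabilities form a Cauchy sequence, being monotone and bounded. -/
lemma exists_crossingProb_sub_le (c : ℕ → ℕ) (hc : ∀ k, 0 < c k) {η : ℝ} (hη : 0 < η) :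
    ∃ m, ∀ n, m ≤ n → crossingProb c hc m - crossingProb c hc n ≤ η := by
  have hanti : Antitone (crossingProb c hc) := fun m n h =>
    sub_nonneg.1 (measureReal_crossing_diff c hc h ▸ measureReal_nonneg)
  have hbdd : BddBelow (Set.range (crossingProb c hc)) :=
    ⟨0, by rintro _ ⟨n, rfl⟩; exact measureReal_nonneg⟩
  obtain ⟨m, hm⟩ := exists_lt_of_ciInf_lt (lt_add_of_pos_right (⨅ n, crossingProb c hc n) hη)
  exact ⟨m, fun n _ => by linarith [ciInf_le hbdd n]⟩

lemma measurePreserving_noiseμ_comp_injective {ι κ : Type} [Fintype ι] [Fintype κ] {p ε : ℝ}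
    (hp0 : 0 ≤ p) (hp1 : p ≤ 1) (hε0 : 0 ≤ ε) (hε1 : ε ≤ 1) (g : κ → ι)
    (hg : Function.Injective g) :
    MeasurePreserving (fun σ : ι → Bool × Bool × Bool => σ ∘ g)
      (noiseμ ι p ε) (noiseμ κ p ε) := by
  have := isProbabilityMeasure_bern hp0 hp1
  have := isProbabilityMeasure_bern hε0 hε1
  exact measurePreserving_pi_comp_injective _ g hg

/-- Disagreement at level `n` is controlled by disagreement at a lower level `m` and the
decrease of the crossing probability between the two levels. -/
lemma noiseμ_crossing_ne_le (c : ℕ → ℕ) (hc : ∀ k, 0 < c k) {m n : ℕ} (h : m ≤ n) {ε : ℝ}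
    (hε0 : 0 ≤ ε) (hε1 : ε ≤ 1) :
    (noiseμ (TEdge c n) (1/2) ε).real
        {σ | crossing c hc n (obs σ) ≠ crossing c hc n (pert σ)}
      ≤ (noiseμ (TEdge c m) (1/2) ε).real {σ | obs σ ≠ pert σ}
        + 2 * (crossingProb c hc m - crossingProb c hc n) := by
  have := isProbabilityMeasure_bern (p := 1/2) (by norm_num) (by norm_num)
  have := isProbabilityMeasure_bern hε0 hε1
  have : IsProbabilityMeasure (noiseμ (TEdge c n) (1/2) ε) := by
    unfold noiseμ
    infer_instance
  set D : Set (TEdge c n → Bool) :=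
    {ω | crossing c hc m (ω ∘ liftEdge c h) = true} \ {ω | crossing c hc n ω = true} with hD
  set B : Set (TEdge c m → Bool × Bool × Bool) := {σ | obs σ ≠ pert σ} with hB
  have hsub : {σ | crossing c hc n (obs σ) ≠ crossing c hc n (pert σ)}
      ⊆ (fun σ => σ ∘ liftEdge c h) ⁻¹' B ∪ (obs ⁻¹' D ∪ pert ⁻¹' D) := by
    intro σ hσ
    by_cases hB' : σ ∘ liftEdge c h ∈ B
    · exact Or.inl hB'
    have heq : obs σ ∘ liftEdge c h = pert σ ∘ liftEdge c h := not_not.1 hB'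
    refine Or.inr ?_
    rcases ho : crossing c hc n (obs σ) with _ | _
    · have hq : crossing c hc n (pert σ) = true := by
        by_contra hq
        exact hσ (by simp [ho, hq])
      have hm := crossing_of_le c hc h _ hq
      rw [← heq] at hm
      exact Or.inl ⟨hm, by simp [ho]⟩
    · have hq : ¬ crossing c hc n (pert σ) = true := fun hq => hσ (by rw [ho, hq])
      have hm := crossing_of_le c hc h _ ho
      rw [heq] at hm
      exact Or.inr ⟨hm, hq⟩
  have hDm : NullMeasurableSet D (Measure.pi fun _ : TEdge c n => bern (1/2)) :=
    (Set.toFinite D).measurableSet.nullMeasurableSet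
  have h1 := (measurePreserving_noiseμ_comp_injective (p := 1/2) (by norm_num) (by norm_num)
    hε0 hε1 _ (liftEdge_injective c h)).measureReal_preimage
      (Set.toFinite B).measurableSet.nullMeasurableSet
  have h2 := (measurePreserving_obs (ι := TEdge c n) (p := 1/2) (by norm_num) (by norm_num)
    hε0 hε1).measureReal_preimage hDm
  have h3 := (measurePreserving_pert (ι := TEdge c n) (p := 1/2) (by norm_num) (by norm_num)
    hε0 hε1).measureReal_preimage hDm
  rw [hD, measureReal_crossing_diff, ← hD] at h2 h3
  calc _ ≤ _ := measureReal_mono hsub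
    _ ≤ _ := (measureReal_union_le _ _).trans (add_le_add_right (measureReal_union_le _ _) _)
    _ = _ := by rw [h1, h2, h3]; ring

/-- the crossing functions of critical (p = 1/2) percolation on a
spherically symmetric tree form a noise stable sequence: for every δ > 0 there is
ε > 0 with sup_n P(f_n(ω_n) ≠ f_n(ω_n^ε)) ≤ δ. -/
theorem stmt_7 (c : ℕ → ℕ) (hc : ∀ k, 0 < c k) :
    ∀ δ : ℝ, 0 < δ → ∃ ε : ℝ, 0 < ε ∧ ∀ n : ℕ,
      ((noiseμ (TEdge c n) (1/2) ε)
        {σ | crossing c hc n (obs σ) ≠ crossing c hc n (pert σ)}).toReal ≤ δ := by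
  intro δ hδ
  obtain ⟨m, hm⟩ := exists_crossingProb_sub_le c hc (η := δ / 4) (by linarith)
  set M := Fintype.card (TEdge c m)
  have hM0 : (0 : ℝ) < M + 1 := by positivity
  set ε : ℝ := min 1 (δ / 2 / (M + 1)) with hε
  have hε0 : 0 < ε := lt_min one_pos (by positivity)
  have hε1 : ε ≤ 1 := min_le_left _ _
  have hMε : (M : ℝ) * ε ≤ δ / 2 := by
    have h := (le_div_iff₀ hM0).1 (min_le_right 1 (δ / 2 / ((M : ℝ) + 1)))
    rw [← hε] at h
    nlinarith
  have hsmall : ∀ k ≤ m, (noiseμ (TEdge c k) (1/2) ε).real {σ | obs σ ≠ pert σ} ≤ δ / 2 := by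
    intro k hk
    refine le_trans (ENNReal.toReal_mono (by finiteness) (noiseμ_obs_ne_pert_le
      (by norm_num) (by norm_num) hε0.le hε1)) ?_
    rw [ENNReal.toReal_mul, ENNReal.toReal_ofReal hε0.le, ENNReal.toReal_natCast]
    refine le_trans ?_ hMε
    gcongr
    exact Fintype.card_le_of_injective _ (liftEdge_injective c hk)
  refine ⟨ε, hε0, fun n => ?_⟩
  have key : ∀ k ≤ n, k ≤ m → crossingProb c hc k - crossingProb c hc n ≤ δ / 4 →
      (noiseμ (TEdge c n) (1/2) ε).real
        {σ | crossing c hc n (obs σ) ≠ crossing c hc n (pert σ)} ≤ δ := by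
    intro k hkn hkm hk
    linarith [noiseμ_crossing_ne_le c hc hkn hε0.le hε1, hsmall k hkm]
  rcases le_total m n with hmn | hnm
  · exact key m hmn le_rfl (hm n hmn)
  · exact key n le_rfl hnm (by linarith)
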